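/- Let p be an odd prime and a ≥ 1 an integer with gcd(a, p) = 1, and let ā denote the image of a in 𝔽_p. Then in 𝔽_p one has b_{τ_p(a)}(ā^{−1}) = (−2/p) · ((p−1)/2)!, where b_{τ_p(a)}(ā^{−1}) denotes the evaluation at ā^{−1} ∈ 𝔽_p of the Bell polynomial b_{τ_p(a)}(x) reduced modulo p, and (−2/p) is the Legendre symbol. -/

import Mathlib

/-- Stirling numbers of the second kind. -/
def stirling2 : ℕ → ℕ → ℕ
  | 0, 0 => 1
  | 0, _ + 1 => 0
  | _ + 1, 0 => 0
  | n + 1, j + 1 => (j + 1) * stirling2 n (j + 1) + stirling2 n j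

/-- Evaluation of the Bell polynomial `b_n(x) = ∑_j S(n,j) x^j`. -/
def bellEval {R : Type*} [CommRing R] (n : ℕ) (x : R) : R :=
  ∑ j ∈ Finset.range (n + 1), (stirling2 n j : R) * x ^ j

/-- `τ_p(a) = ∑_{j=1}^{p-1} j p^{ja-1}`. -/
def tauP (p a : ℕ) : ℕ := ∑ j ∈ Finset.Icc 1 (p - 1), j * p ^ (j * a - 1)

open Finset Polynomial

/-- The staircase product `∏_{j<n} (y + j)^{n-1-j}`, i.e. the product of the rising factorials
`y (y + 1) ⋯ (y + i)` for `i < n - 1`. -/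
def staircase {R : Type*} [CommRing R] (n : ℕ) (y : R) : R :=
  ∏ j ∈ range n, (y + j) ^ (n - 1 - j)

theorem map_staircase {R S : Type*} [CommRing R] [CommRing S] (φ : R →+* S) (n : ℕ) (y : R) :
    φ (staircase n y) = staircase n (φ y) := by
  simp [staircase]

theorem staircase_succ {R : Type*} [CommRing R] (n : ℕ) (y : R) :
    staircase (n + 1) y = staircase n y * ∏ j ∈ range n, (y + j) := by
  rw [staircase, prod_range_succ, Nat.add_sub_cancel, Nat.sub_self, pow_zero, mul_one, staircase,
    ← prod_mul_distrib]
  refine prod_congr rfl fun j hj ↦ ?_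
  rw [← pow_succ]
  congr 1
  have := mem_range.1 hj
  lia

theorem staircase_add_one_mul_pow {R : Type*} [CommRing R] (n : ℕ) (y : R) :
    staircase n (y + 1) * y ^ n = staircase n y * ∏ j ∈ range n, (y + j) := by
  rw [← staircase_succ, staircase, staircase, prod_range_succ']
  congr 1
  · refine prod_congr rfl fun j _ ↦ ?_
    push_cast
    rw [add_assoc, add_comm (1 : R), Nat.sub_sub, add_comm 1]
  · simp

theorem staircase_succ_one {R : Type*} [CommRing R] (n : ℕ) :
    staircase (n + 1) (1 : R) = (Nat.superFactorial n : R) := by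
  induction n with
  | zero => simp [staircase]
  | succ n ih =>
    rw [staircase_succ, ih, Nat.superFactorial_succ, ← prod_range_add_one_eq_factorial, mul_comm]
    push_cast
    simp_rw [add_comm (1 : R)]

theorem sum_range_add_one_of_charP {R M : Type*} [CommRing R] [AddCommMonoid M] (p : ℕ)
    [CharP R p] (f : R → M) (y : R) :
    ∑ k ∈ range p, f (y + k + 1) = ∑ k ∈ range p, f (y + k) := by
  cases p with
  | zero => simp
  | succ n =>
    rw [sum_range_succ, sum_range_succ']
    have : (n : R) + 1 = 0 := by exact_mod_cast CharP.cast_eq_zero R (n + 1)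
    simp [add_assoc, this]

@[to_additive]
theorem prod_range_cast_zmod {M : Type*} [CommMonoid M] (p : ℕ) [NeZero p] (f : ZMod p → M) :
    ∏ k ∈ range p, f k = ∏ a, f a := by
  refine prod_bij (fun k _ ↦ (k : ZMod p)) (by simp) (fun i hi j hj h ↦ ?_)
    (fun a _ ↦ ⟨a.val, mem_range.2 a.val_lt, by simp⟩) (by simp)
  rw [ZMod.natCast_eq_natCast_iff'] at h
  rwa [Nat.mod_eq_of_lt (mem_range.1 hi), Nat.mod_eq_of_lt (mem_range.1 hj)] at h

theorem stirling2_eq_zero_of_lt : ∀ {n j : ℕ}, n < j → stirling2 n j = 0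
  | 0, j + 1, _ => by rw [stirling2]
  | n + 1, j + 1, h => by
    rw [stirling2, stirling2_eq_zero_of_lt (by lia : n < j + 1),
      stirling2_eq_zero_of_lt (by lia : n < j), mul_zero]

section CharP

variable {R : Type*} [CommRing R] (p : ℕ) [Fact p.Prime] [CharP R p]

theorem prod_range_add_cast_eq_pow_sub (y : R) : ∏ j ∈ range p, (y + j) = y ^ p - y := by
  have h : ∏ a : ZMod p, ((X : (ZMod p)[X]) - C a) = X ^ p - X := by
    have hp := (Fact.out : p.Prime).one_lt
    have hr := FiniteField.roots_X_pow_card_sub_X (ZMod p)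
    rw [ZMod.card] at hr
    have hm : (X ^ p - X : (ZMod p)[X]).Monic :=
      monic_X_pow_sub (by rw [degree_X]; exact_mod_cast hp)
    have := prod_multiset_X_sub_C_of_monic_of_roots_card_eq hm (by
      rw [hr, FiniteField.X_pow_card_sub_X_natDegree_eq _ hp]
      simp [ZMod.card])
    rwa [hr] at this
  rw [← Equiv.prod_comp (Equiv.neg (ZMod p)), ← prod_range_cast_zmod] at h
  have := congrArg (eval₂ (ZMod.castHom dvd_rfl R) y) h
  simpa [eval₂_finsetProd] using this

theorem eq_C_of_natDegree_lt_of_eval_eq {f : (ZMod p)[X]} (hf : f.natDegree < p) {b : ZMod p}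
    (h : ∀ a, f.eval a = b) : f = C b := by
  refine eq_of_natDegree_lt_card_of_eval_eq f (C b) Function.injective_id (by simpa using h) ?_
  simpa [ZMod.card] using hf

theorem sum_add_cast_pow_sub_one (t : R) : ∑ k ∈ range p, (t + k) ^ (p - 1) = -1 := by
  have hp := (Fact.out : p.Prime).one_lt
  have h : ∑ k ∈ range p, ((X : (ZMod p)[X]) + k) ^ (p - 1) = C (-1) := by
    refine eq_C_of_natDegree_lt_of_eval_eq p ?_ fun a ↦ ?_
    · refine lt_of_le_of_lt (natDegree_sum_le_of_forall_le (n := p - 1) _ _ fun k _ ↦ ?_) (by lia)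
      have h1 : ((X : (ZMod p)[X]) + k).natDegree ≤ 1 := by
        rw [← C_eq_natCast, natDegree_X_add_C]
      simpa using natDegree_pow_le_of_le (p - 1) h1
    · have h1 : ∑ b : ZMod p, b ^ (p - 1) = -1 := by
        have h0 (b : ZMod p) : b ^ (p - 1) = 1 - if b = 0 then 1 else 0 := by
          split_ifs with hb
          · rw [hb, zero_pow (by lia), sub_self]
          · rw [ZMod.pow_card_sub_one_eq_one hb, sub_zero]
        simp [h0, ZMod.card]
      rw [eval_finsetSum]
      simp only [eval_pow, eval_add, eval_X, eval_natCast]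
      rw [sum_range_cast_zmod p (fun b ↦ (a + b) ^ (p - 1)),
        ← h1]
      exact Equiv.sum_comp (Equiv.addLeft a) (fun b ↦ b ^ (p - 1))
  have := congrArg (eval₂ (ZMod.castHom dvd_rfl R) t) h
  simpa [eval₂_finsetSum, eval₂_pow] using this

theorem sum_staircase_mul_one_sub (y : R) :
    ∑ k ∈ range p, staircase p (y + k) * (1 - (y + k)) = 0 := by
  have h (z : R) : staircase p z * (1 - z) =
      staircase p (z + 1) * ((z + 1) ^ p - 1) - staircase p z * (z ^ p - 1) := by
    have := staircase_add_one_mul_pow p z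
    rw [prod_range_add_cast_eq_pow_sub] at this
    rw [add_pow_char, one_pow]
    linear_combination -this
  simp_rw [h, sum_sub_distrib]
  rw [sum_range_add_one_of_charP p (fun z : R ↦ staircase p z * (z ^ p - 1)), sub_self]

theorem derivative_staircase_mul :
    derivative (staircase p (X : R[X])) * (X ^ p - X) = staircase p X * (1 - X) := by
  classical
  have hP := prod_range_add_cast_eq_pow_sub p (X : R[X])
  have hP' : ∑ i ∈ range p, ∏ j ∈ (range p).erase i, ((X : R[X]) + j) = -1 := by
    have := congrArg derivative hP
    simpa [derivative_prod_finset, derivative_pow] using this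
  rw [← hP, staircase, derivative_prod_finset, sum_mul]
  have h : ∀ i ∈ range p, (∏ j ∈ (range p).erase i, ((X : R[X]) + j) ^ (p - 1 - j)) *
      derivative (((X : R[X]) + (i : R[X])) ^ (p - 1 - i)) * ∏ j ∈ range p, ((X : R[X]) + j) =
      (∏ j ∈ range p, ((X : R[X]) + j) ^ (p - 1 - j)) *
        ((X - 1) * ∏ j ∈ (range p).erase i, ((X : R[X]) + j) -
          ∏ j ∈ range p, ((X : R[X]) + j)) := by
    intro i hi
    rw [← mul_prod_erase _ (fun j : ℕ ↦ ((X : R[X]) + j) ^ (p - 1 - j)) hi,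
      ← mul_prod_erase _ (fun j : ℕ ↦ ((X : R[X]) + j)) hi]
    have hd : derivative (((X : R[X]) + (i : R[X])) ^ (p - 1 - i)) * (X + (i : R[X])) =
        (X + (i : R[X])) ^ (p - 1 - i) * (X - 1 - (X + (i : R[X]))) := by
      have hi' := mem_range.1 hi
      have hc : ((p - 1 - i : ℕ) : R[X]) = -1 - i := by
        have : ((p - 1 - i : ℕ) : R[X]) + 1 + i = (p : ℕ) := by
          norm_cast
          congr 1
          lia
        rw [CharP.cast_eq_zero R[X] p] at this
        linear_combination this
      rw [derivative_pow]
      simp only [derivative_add, derivative_X, derivative_natCast, add_zero, mul_one, map_natCast]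
      rw [hc]
      rcases Nat.eq_zero_or_pos (p - 1 - i) with h0 | h0
      · have : (-1 - i : R[X]) = 0 := by rw [← hc, h0, Nat.cast_zero]
        rw [this]
        linear_combination -((X : R[X]) + i) ^ (p - 1 - i) * this
      · obtain ⟨m, hm⟩ := Nat.exists_eq_succ_of_ne_zero h0.ne'
        rw [hm]
        simp only [Nat.succ_eq_add_one, Nat.add_sub_cancel, pow_succ]
        ring
    linear_combination (∏ j ∈ (range p).erase i, ((X : R[X]) + j) ^ (p - 1 - j)) *
      (∏ j ∈ (range p).erase i, ((X : R[X]) + j)) * hd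
  rw [sum_congr rfl h, ← mul_sum, sum_sub_distrib, ← mul_sum, hP']
  simp

theorem sum_staircase_zmod : ∑ b : ZMod p, staircase p b = (Nat.superFactorial (p - 1) : ZMod p) := by
  have hp := (Fact.out : p.Prime).one_lt
  rw [sum_eq_single 1, ← staircase_succ_one, Nat.sub_add_cancel hp.le]
  · intro b _ hb
    refine prod_eq_zero (mem_range.2 (-b).val_lt) ?_
    rw [ZMod.natCast_val, ZMod.cast_id', id, add_neg_cancel]
    refine zero_pow fun h ↦ hb ?_
    have hv : (-b).val = p - 1 := by
      have := (-b).val_lt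
      lia
    have hb' : -b = ((p - 1 : ℕ) : ZMod p) := by rw [← hv, ZMod.natCast_val, ZMod.cast_id', id]
    rw [Nat.cast_sub hp.le, CharP.cast_eq_zero, zero_sub, Nat.cast_one] at hb'
    exact neg_injective hb'
  · simp

theorem derivative_sum_staircase_X_add :
    derivative (∑ k ∈ range p, staircase p ((X : (ZMod p)[X]) + (k : (ZMod p)[X]))) = 0 := by
  have hp := (Fact.out : p.Prime).one_lt
  have hne := FiniteField.X_pow_card_sub_X_ne_zero (ZMod p) hp
  refine (mul_eq_zero.1 ?_).resolve_right hne
  rw [derivative_sum, sum_mul, ← sum_staircase_mul_one_sub p (X : (ZMod p)[X])]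
  refine sum_congr rfl fun k _ ↦ ?_
  set g : (ZMod p)[X] := X + (k : (ZMod p)[X]) with hg
  have hcomp : staircase p g = (staircase p X).comp g := by
    simpa using (map_staircase (compRingHom g) p X).symm
  have hk : ((k : (ZMod p)[X])) ^ p = k := by
    rw [← C_eq_natCast, ← C_pow, ZMod.pow_card]
  have hgp : g ^ p - g = X ^ p - X := by
    rw [hg, add_pow_char, hk]
    ring
  have hg' : derivative g = 1 := by simp [hg]
  have h := congrArg (fun f : (ZMod p)[X] ↦ f.comp g) (derivative_staircase_mul (R := ZMod p) p)
  simp only [mul_comp, sub_comp, pow_comp, X_comp, one_comp, hgp] at h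
  rw [hcomp, derivative_comp, ← h, hg', one_mul]

theorem sum_staircase_add_cast (y : R) :
    ∑ k ∈ range p, staircase p (y + k) = (Nat.superFactorial (p - 1) : R) := by
  have hp := (Fact.out : p.Prime).one_lt
  set E : (ZMod p)[X] := ∑ k ∈ range p, staircase p ((X : (ZMod p)[X]) + (k : (ZMod p)[X])) with hE
  have hexp : expand (ZMod p) p (contract p E) = E :=
    expand_contract p (derivative_sum_staircase_X_add p) (by lia)
  have hdeg : E.natDegree ≤ p * (p - 1) := by
    refine natDegree_sum_le_of_forall_le _ _ fun k _ ↦ (natDegree_prod_le _ _).trans ?_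
    refine (sum_le_card_nsmul _ _ (p - 1) fun j _ ↦ ?_).trans (by simp)
    have h1 : ((X : (ZMod p)[X]) + k + j).natDegree ≤ 1 := by
      rw [add_assoc, ← Nat.cast_add, ← C_eq_natCast, natDegree_X_add_C]
    refine (natDegree_pow_le_of_le (p - 1 - j) h1).trans ?_
    lia
  have hcdeg : (contract p E).natDegree < p := by
    rw [← hexp, natDegree_expand, mul_comm] at hdeg
    have := Nat.le_of_mul_le_mul_left hdeg (by lia)
    lia
  have heval (a : ZMod p) : (contract p E).eval a = (Nat.superFactorial (p - 1) : ZMod p) := by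
    have h1 : (contract p E).eval a = E.eval a := by
      rw [← hexp, expand_eval, ZMod.pow_card, hexp]
    have h2 (k : ℕ) : (staircase p ((X : (ZMod p)[X]) + k)).eval a = staircase p (a + k) := by
      simpa using map_staircase (evalRingHom a) p ((X : (ZMod p)[X]) + k)
    rw [h1, hE, eval_finsetSum, sum_congr rfl fun k _ ↦ h2 k,
      sum_range_cast_zmod p (fun b ↦ staircase p (a + b)), ← sum_staircase_zmod]
    exact Equiv.sum_comp (Equiv.addLeft a) (fun b ↦ staircase p b)
  have hconst : E = C (Nat.superFactorial (p - 1) : ZMod p) := by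
    rw [← hexp, eq_C_of_natDegree_lt_of_eval_eq p hcdeg heval, expand_C]
  have h := congrArg (eval₂RingHom (ZMod.castHom dvd_rfl R) y) hconst
  rw [hE, map_sum] at h
  simpa [map_staircase] using h

theorem pow_eq_sum_stirling2 {R : Type*} [CommRing R] (n : ℕ) (z : R) :
    z ^ n = ∑ j ∈ range (n + 1), (stirling2 n j : R) * ∏ i ∈ range j, (z - i) := by
  induction n with
  | zero => simp [stirling2]
  | succ n ih =>
    have hz (j : ℕ) : (stirling2 n j : R) * (∏ i ∈ range j, (z - i)) * z =
        (stirling2 n j : R) * ∏ i ∈ range (j + 1), (z - i) +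
          (j * stirling2 n j : R) * ∏ i ∈ range j, (z - i) := by
      rw [prod_range_succ]
      ring
    have hlast : stirling2 n (n + 1) = 0 := stirling2_eq_zero_of_lt (Nat.lt_succ_self n)
    have hshift : ∑ j ∈ range (n + 1), (j * stirling2 n j : R) * ∏ i ∈ range j, (z - i) =
        ∑ j ∈ range (n + 1), (((j + 1 : ℕ) : R) * stirling2 n (j + 1)) *
          ∏ i ∈ range (j + 1), (z - i) := by
      rw [sum_range_succ', sum_range_succ _ n, hlast]
      simp
    rw [pow_succ, ih, sum_mul, sum_congr rfl fun j _ ↦ hz j, sum_add_distrib, hshift,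
      sum_range_succ' _ (n + 1), ← sum_add_distrib]
    simp only [stirling2, Nat.cast_zero, zero_mul, add_zero]
    refine sum_congr rfl fun j _ ↦ ?_
    push_cast
    ring

theorem map_bellEval {R S : Type*} [CommRing R] [CommRing S] (φ : R →+* S) (n : ℕ) (x : R) :
    φ (bellEval n x) = bellEval n (φ x) := by
  simp [bellEval]

theorem sum_prod_mul_staircase {y c : R} (hy : y ^ p = y + c) (n : ℕ) :
    ∑ k ∈ range p, (∏ i ∈ range n, (y + c + k - i)) * staircase p (y + k + 1) =
      c ^ n * ∑ k ∈ range p, staircase p (y + k) := by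
  induction n with
  | zero => simpa using sum_range_add_one_of_charP p (fun z : R ↦ staircase p z) y
  | succ n ih =>
    rw [pow_succ', mul_assoc, ← ih, mul_sum]
    have hF := sum_range_add_one_of_charP p
      (fun z : R ↦ c * ((∏ i ∈ range n, (z - 1 + c - i)) * staircase p z)) y
    have hk (k : ℕ) : (y + k) ^ p = y + k + c := by
      have : ((k : R)) ^ p = k := by
        rw [← map_natCast (ZMod.castHom dvd_rfl R : ZMod p →+* R) k, ← map_pow, ZMod.pow_card]
      rw [add_pow_char, hy, this]
      ring
    refine Eq.trans ?_ (hF.symm.trans ?_)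
    · refine sum_congr rfl fun k _ ↦ ?_
      have h := staircase_add_one_mul_pow p (y + k)
      rw [prod_range_add_cast_eq_pow_sub, hk] at h
      rw [prod_range_succ']
      have hprod : ∏ i ∈ range n, (y + c + k - ((i + 1 : ℕ) : R)) =
          ∏ i ∈ range n, (y + k - 1 + c - i) :=
        prod_congr rfl fun i _ ↦ by push_cast; ring
      rw [hprod, Nat.cast_zero]
      linear_combination (∏ i ∈ range n, (y + k - 1 + c - i)) * h
    · refine sum_congr rfl fun k _ ↦ ?_
      have hprod : ∏ i ∈ range n, (y + k + 1 - 1 + c - (i : R)) =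
          ∏ i ∈ range n, (y + c + k - i) :=
        prod_congr rfl fun i _ ↦ by ring
      rw [hprod]

theorem sum_pow_mul_staircase {y c : R} (hy : y ^ p = y + c) (n : ℕ) :
    ∑ k ∈ range p, (y + c + k) ^ n * staircase p (y + k + 1) =
      bellEval n c * ∑ k ∈ range p, staircase p (y + k) := by
  simp_rw [pow_eq_sum_stirling2 n, sum_mul]
  rw [sum_comm, bellEval, sum_mul]
  refine sum_congr rfl fun j _ ↦ ?_
  rw [mul_assoc, ← sum_prod_mul_staircase p hy, mul_sum]
  simp_rw [mul_assoc]


theorem pow_pow_char_eq_add_mul {y c : R} (hy : y ^ p = y + c) (hc : c ^ p = c) (m : ℕ) :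
    y ^ p ^ m = y + m * c := by
  induction m with
  | zero => simp
  | succ m ih =>
    have hm : (m : R) ^ p = m := by
      rw [← map_natCast (ZMod.castHom dvd_rfl R : ZMod p →+* R) m, ← map_pow, ZMod.pow_card]
    rw [pow_succ, pow_mul, ih, add_pow_char, mul_pow, hy, hc, hm]
    push_cast
    ring

theorem prod_pow_mul_staircase_add_one (y : R) :
    (∏ j ∈ Icc 1 (p - 1), (y + j) ^ j) * staircase p (y + 1) =
      (∏ j ∈ Icc 1 (p - 1), (y + j)) ^ p := by
  obtain ⟨n, rfl⟩ := Nat.exists_eq_succ_of_ne_zero (Fact.out : p.Prime).ne_zero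
  have h : staircase (n + 1) (y + 1) = ∏ j ∈ Icc 1 n, (y + j) ^ (n + 1 - j) := by
    rw [staircase, prod_range_succ, Nat.add_sub_cancel, Nat.sub_self, pow_zero, mul_one,
      ← Ico_add_one_right_eq_Icc, prod_Ico_eq_prod_range, Nat.add_sub_cancel]
    refine prod_congr rfl fun j _ ↦ ?_
    rw [Nat.add_comm 1 j, Nat.add_sub_add_right]
    push_cast
    ring
  rw [Nat.succ_eq_add_one, Nat.add_sub_cancel, h, ← prod_mul_distrib, ← prod_pow]
  refine prod_congr rfl fun j hj ↦ ?_
  rw [← pow_add]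
  congr 1
  have := mem_Icc.1 hj
  lia

end CharP

section Field

variable {K : Type*} [Field K] (p : ℕ) [Fact p.Prime] [CharP K p]

theorem pow_tauP_mul_staircase {a : ℕ} (ha : 1 ≤ a) {y c : K} (hac : a * c = 1)
    (hy : y ^ p = y + c) (hc : c ^ p = c) :
    (y + c) ^ tauP p a * staircase p (y + 1) = (y + c) ^ (p - 1) - 1 := by
  have hp := (Fact.out : p.Prime).one_lt
  have hy0 : y ≠ 0 := by
    rintro rfl
    rw [zero_pow (by lia), zero_add] at hy
    simp [← hy] at hac
  have hz : (y + c) ^ p = y + c + c := by rw [add_pow_char, hy, hc]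
  have hpow : (y + c) ^ tauP p a = ∏ j ∈ Icc 1 (p - 1), (y + j) ^ j := by
    rw [tauP, ← prod_pow_eq_pow_sum]
    refine prod_congr rfl fun j hj ↦ ?_
    have hja : 1 ≤ j * a := Nat.mul_pos (mem_Icc.1 hj).1 ha
    rw [mul_comm, pow_mul, pow_pow_char_eq_add_mul p hz hc, Nat.cast_sub hja]
    congr 1
    push_cast
    linear_combination (j : K) * hac
  have hprod : ∏ j ∈ Icc 1 (p - 1), (y + j) = y ^ (p - 1) - 1 := by
    have h := prod_range_add_cast_eq_pow_sub p y
    obtain ⟨n, rfl⟩ := Nat.exists_eq_succ_of_ne_zero (Fact.out : p.Prime).ne_zero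
    rw [prod_range_succ', Nat.cast_zero, add_zero] at h
    apply mul_right_cancel₀ hy0
    rw [Nat.succ_eq_add_one, Nat.add_sub_cancel, ← Ico_add_one_right_eq_Icc,
      prod_Ico_eq_prod_range, Nat.add_sub_cancel]
    simp_rw [Nat.add_comm 1]
    rw [h, pow_succ]
    ring
  rw [hpow, prod_pow_mul_staircase_add_one, hprod, sub_pow_char, one_pow, ← pow_mul, mul_comm,
    pow_mul, hy]

theorem bellEval_tauP_mul_superFactorial {a : ℕ} (ha : 1 ≤ a) {y c : K} (hac : a * c = 1)
    (hy : y ^ p = y + c) (hc : c ^ p = c) :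
    bellEval (tauP p a) c * (Nat.superFactorial (p - 1) : K) = -1 := by
  have hyk (k : ℕ) : (y + k) ^ p = y + k + c := by
    have hk : (k : K) ^ p = k := by
      rw [← map_natCast (ZMod.castHom dvd_rfl K : ZMod p →+* K) k, ← map_pow, ZMod.pow_card]
    rw [add_pow_char, hy, hk]
    ring
  rw [← sum_staircase_add_cast p y, ← sum_pow_mul_staircase p hy]
  simp_rw [add_right_comm y c, pow_tauP_mul_staircase p ha hac (hyk _) hc, add_right_comm y _ c]
  rw [sum_sub_distrib, sum_add_cast_pow_sub_one]
  simp

end Field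

section ZMod

variable (p : ℕ) [Fact p.Prime]

theorem bellEval_tauP_inv_mul_superFactorial {a : ℕ} (ha : 1 ≤ a) (hap : (a : ZMod p) ≠ 0) :
    bellEval (tauP p a) ((a : ZMod p)⁻¹) * (Nat.superFactorial (p - 1) : ZMod p) = -1 := by
  have hp := (Fact.out : p.Prime).one_lt
  let φ := algebraMap (ZMod p) (AlgebraicClosure (ZMod p))
  have hφ : Function.Injective φ := φ.injective
  have : CharP (AlgebraicClosure (ZMod p)) p := charP_of_injective_ringHom hφ p
  set c := φ (a : ZMod p)⁻¹ with hcdef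
  obtain ⟨y, hy⟩ : ∃ y, IsRoot (X ^ p - (X + C c)) y := by
    refine IsAlgClosed.exists_root _ ?_
    rw [degree_sub_eq_left_of_degree_lt, degree_X_pow]
    · exact_mod_cast (by lia : p ≠ 0)
    · rw [degree_X_pow, degree_X_add_C]
      exact_mod_cast hp
  have hy' : y ^ p = y + c := by simpa [sub_eq_zero] using hy
  have hc : c ^ p = c := by rw [hcdef, ← map_pow, ZMod.pow_card]
  have hac : a * c = 1 := by
    rw [hcdef, ← map_natCast φ, ← map_mul, mul_inv_cancel₀ hap, map_one]
  apply hφ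
  rw [map_mul, map_bellEval, map_natCast, map_neg, map_one]
  exact bellEval_tauP_mul_superFactorial p ha hac hy' hc

theorem factorial_mul_factorial_sub_zmod {i : ℕ} (hi : i < p) :
    (i.factorial * (p - 1 - i).factorial : ZMod p) = (-1) ^ (i + 1) := by
  induction i with
  | zero => simp [ZMod.wilsons_lemma]
  | succ i ih =>
    obtain ⟨m, hm⟩ : ∃ m, p - 1 - i = m + 1 := ⟨p - 1 - i - 1, by lia⟩
    have h := ih (by lia)
    have hmi : ((m : ZMod p) + 1) = -(i + 1) := by
      have : ((m + 1 + i + 1 : ℕ) : ZMod p) = 0 := by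
        rw [show m + 1 + i + 1 = p by lia, CharP.cast_eq_zero]
      push_cast at this
      linear_combination this
    rw [hm, Nat.factorial_succ] at h
    rw [show p - 1 - (i + 1) = m by lia, Nat.factorial_succ, pow_succ, ← h]
    push_cast
    rw [hmi]
    ring

theorem superFactorial_zmod {m : ℕ} (hm : p = 2 * m + 1) :
    (Nat.superFactorial (p - 1) : ZMod p) =
      (∏ i ∈ range m, (-1) ^ (i + 1)) * (m.factorial : ZMod p) := by
  have h : ∏ i ∈ range (m + 1), (m + i).factorial =
      (∏ i ∈ range m, (p - 1 - i).factorial) * m.factorial := by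
    rw [← prod_range_reflect, prod_range_succ]
    congr 1
    · refine prod_congr rfl fun i hi ↦ ?_
      have := mem_range.1 hi
      congr 1
      lia
    · simp
  rw [← Nat.prod_range_succ_factorial, show p - 1 + 1 = m + (m + 1) by lia, prod_range_add, h,
    ← mul_assoc, ← prod_mul_distrib]
  push_cast
  congr 1
  refine prod_congr rfl fun i hi ↦ factorial_mul_factorial_sub_zmod p ?_
  have := mem_range.1 hi
  lia

theorem chi_eight_mul_prod_neg_one_pow (m : ℕ) :
    ZMod.χ₈' ((2 * m + 1 : ℕ) : ZMod 8) * (-1) ^ (m + 1) * ∏ i ∈ range m, (-1) ^ (i + 1) = -1 := by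
  induction m using Nat.strong_induction_on with
  | _ m ih =>
    rcases Nat.lt_or_ge m 4 with h | h
    · interval_cases m <;> decide
    · obtain ⟨n, rfl⟩ := Nat.exists_eq_add_of_le' h
      have hχ : ((2 * (n + 4) + 1 : ℕ) : ZMod 8) = ((2 * n + 1 : ℕ) : ZMod 8) := by
        rw [ZMod.natCast_eq_natCast_iff']
        lia
      rw [hχ]
      refine Eq.trans ?_ (ih n (by lia))
      have hs : ((-1 : ℤ) ^ n) ^ 4 = 1 := by
        rw [← pow_mul, mul_comm, pow_mul]
        simp
      simp only [prod_range_succ, pow_add (-1 : ℤ) n, add_assoc]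
      generalize (-1 : ℤ) ^ n = e at hs ⊢
      generalize ∏ i ∈ range n, (-1 : ℤ) ^ (i + 1) = P
      linear_combination (-ZMod.χ₈' ((2 * n + 1 : ℕ) : ZMod 8) * e * P) * hs

end ZMod

/-- For an odd prime `p` and `a ≥ 1` with `gcd(a,p) = 1`, in `𝔽_p` one has
`b_{τ_p(a)}(a⁻¹) = (-2/p)·((p-1)/2)!`. -/
theorem bell_tauP_eq_legendre_mul_factorial (p : ℕ) [Fact p.Prime] (hodd : p ≠ 2)
    (a : ℕ) (ha : 1 ≤ a) (hap : Nat.gcd a p = 1) :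
    bellEval (tauP p a) ((a : ZMod p)⁻¹) =
      ((legendreSym p (-2) : ℤ) : ZMod p) * (Nat.factorial ((p - 1) / 2) : ZMod p) := by
  have hp : p.Prime := Fact.out
  obtain ⟨m, hm⟩ := hp.odd_of_ne_two hodd
  have ha0 : (a : ZMod p) ≠ 0 := by
    rw [Ne, ZMod.natCast_eq_zero_iff]
    exact (hp.coprime_iff_not_dvd).1 (Nat.Coprime.symm hap)
  have hbell := bellEval_tauP_inv_mul_superFactorial p ha ha0
  have hsq : (m.factorial * m.factorial : ZMod p) = (-1) ^ (m + 1) := by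
    rw [← factorial_mul_factorial_sub_zmod p (by lia : m < p), show p - 1 - m = m by lia]
  have hsign := congrArg (Int.cast : ℤ → ZMod p) (chi_eight_mul_prod_neg_one_pow m)
  rw [← hm, ← legendreSym.at_neg_two hodd] at hsign
  push_cast at hsign
  have hne : (Nat.superFactorial (p - 1) : ZMod p) ≠ 0 := by
    intro h
    simp [h] at hbell
  apply mul_right_cancel₀ hne
  rw [hbell, superFactorial_zmod p hm, show (p - 1) / 2 = m by lia]
  refine hsign.symm.trans ?_
  rw [← hsq]
  generalize ∏ i ∈ range m, (-1 : ZMod p) ^ (i + 1) = P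
  ring
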